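/- For every x ≥ 0 and ε > 0, if T_a^{(x+ε),+} < τ_0^{(x+ε),−}, then inf{t > 0 : L^{(x+ε)}(t) − L^{(x)}(t) > 0} ≥ T_a^{(x+ε),+} (with inf ∅ := +∞); in particular L^{(x+ε)}(t) = L^{(x)}(t) for all t ∈ [0, T_a^{(x+ε),+}). -/

import Mathlib

open Filter Set

/-- A càdlàg function: right-continuous with left limits. -/
def CadlagFun (f : ℝ → ℝ) : Prop :=
  (∀ t : ℝ, ContinuousWithinAt f (Set.Ici t) t) ∧
  (∀ t : ℝ, ∃ l : ℝ, Tendsto f (nhdsWithin t (Set.Iio t)) (nhds l))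

/-- A strictly increasing sequence of times starting at `0` and tending to `∞`. -/
def IsTimeGrid (T : ℕ → ℝ) : Prop :=
  T 0 = 0 ∧ StrictMono T ∧ Tendsto T atTop atTop

/-- The periodic-classical reflected triple `(U, L, R)` of the path `t ↦ y + f t`:
classical reflection below at level `0`, periodic reflection above at level `a` at the
times `T k`, defined by the recursive specification. -/
structure IsPCTriple (a : ℝ) (T : ℕ → ℝ) (f : ℝ → ℝ) (y : ℝ)
    (U L R : ℝ → ℝ) : Prop where
  L_first : ∀ t : ℝ, 0 ≤ t → t < T 1 → L t = 0
  R_first : ∀ t : ℝ, 0 ≤ t → t < T 1 →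
    R t = max 0 (-sInf ((fun s => y + f s) '' Set.Icc 0 t))
  U_first : ∀ t : ℝ, 0 ≤ t → t < T 1 → U t = y + f t + R t
  R_seg : ∀ (k : ℕ) (t : ℝ), T k < t → t < T (k + 1) →
    R t = R (T k) + max 0 (-sInf ((fun s => U (T k) + f s - f (T k)) '' Set.Icc (T k) t))
  U_seg : ∀ (k : ℕ) (t : ℝ), T k < t → t < T (k + 1) →
    U t = (U (T k) + f t - f (T k)) + (R t - R (T k))
  L_seg : ∀ (k : ℕ) (t : ℝ), T k < t → t < T (k + 1) → L t = L (T k)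
  R_jump : ∀ k : ℕ, R (T (k + 1)) = R (T k) +
    max 0 (-sInf ((fun s => U (T k) + f s - f (T k)) '' Set.Icc (T k) (T (k + 1))))
  L_jump : ∀ k : ℕ, L (T (k + 1)) = L (T k) +
    max (((U (T k) + f (T (k + 1)) - f (T k)) + (R (T (k + 1)) - R (T k))) - a) 0
  U_jump : ∀ k : ℕ, U (T (k + 1)) =
    min ((U (T k) + f (T (k + 1)) - f (T k)) + (R (T (k + 1)) - R (T k))) a

/-- `τ_0^{(y),-} = inf {t ≥ 0 : y + f t < 0}`, with `inf ∅ = +∞`, as an extended real. -/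
noncomputable def tauMinus (f : ℝ → ℝ) (y : ℝ) : EReal :=
  sInf ((fun t : ℝ => (t : EReal)) '' {t : ℝ | 0 ≤ t ∧ y + f t < 0})

/-- `T_a^{(y),+} = inf {T k : k ≥ 1, y + f (T k) > a}`, with `inf ∅ = +∞`. -/
noncomputable def TPlus (a : ℝ) (T : ℕ → ℝ) (f : ℝ → ℝ) (y : ℝ) : EReal :=
  sInf ((fun t : ℝ => (t : EReal)) ''
    {t : ℝ | ∃ k : ℕ, 1 ≤ k ∧ t = T k ∧ a < y + f (T k)})

theorem nonneg_of_lt_tauMinus {f : ℝ → ℝ} {y s : ℝ} (hs : 0 ≤ s)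
    (h : (s : EReal) < tauMinus f y) : 0 ≤ y + f s := by
  by_contra! hneg
  have hle : tauMinus f y ≤ s := sInf_le ⟨s, ⟨hs, hneg⟩, rfl⟩
  exact hle.not_gt h

theorem le_of_lt_TPlus {a : ℝ} {T : ℕ → ℝ} {f : ℝ → ℝ} {y : ℝ} {k : ℕ} (hk : 1 ≤ k)
    (h : (T k : EReal) < TPlus a T f y) : y + f (T k) ≤ a := by
  by_contra! hgt
  have hle : TPlus a T f y ≤ T k := sInf_le ⟨T k, ⟨k, hk, rfl, hgt⟩, rfl⟩
  exact hle.not_gt h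

theorem IsTimeGrid.exists_mem_Ico {T : ℕ → ℝ} (hT : IsTimeGrid T) {t : ℝ} (ht : 0 ≤ t) :
    ∃ k : ℕ, T k ≤ t ∧ t < T (k + 1) := by
  classical
  have hex : ∃ n, t < T n := (hT.2.2.eventually_gt_atTop t).exists
  obtain ⟨k, hk⟩ : ∃ k, Nat.find hex = k + 1 := by
    refine Nat.exists_eq_succ_of_ne_zero fun h0 => ?_
    have := Nat.find_spec hex
    rw [h0, hT.1] at this
    linarith
  refine ⟨k, not_lt.mp (Nat.find_min hex (by omega)), ?_⟩
  rw [← hk]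
  exact Nat.find_spec hex

/-- If a path stays above `-d`, then the classical reflection at `0` pushes it by at most `d`. -/
theorem max_zero_neg_sInf_image_Icc_le {g : ℝ → ℝ} {u v d : ℝ} (huv : u ≤ v) (hd : 0 ≤ d)
    (hg : ∀ s ∈ Set.Icc u v, -d ≤ g s) : max 0 (-sInf (g '' Set.Icc u v)) ≤ d := by
  have : -d ≤ sInf (g '' Set.Icc u v) :=
    le_csInf ((Set.nonempty_Icc.mpr huv).image g) (by rintro _ ⟨s, hs, rfl⟩; exact hg s hs)
  exact max_le hd (by linarith)

namespace IsPCTriple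

variable {a : ℝ} {T : ℕ → ℝ} {f : ℝ → ℝ} {y : ℝ} {U L R : ℝ → ℝ}

theorem L_zero (h : IsPCTriple a T f y U L R) (hT : IsTimeGrid T) : L 0 = 0 :=
  h.L_first 0 le_rfl (hT.1 ▸ hT.2.1 zero_lt_one)

theorem U_zero (h : IsPCTriple a T f y U L R) (hT : IsTimeGrid T) (hf0 : f 0 = 0)
    (hy : 0 ≤ y) : U 0 = y := by
  have h1 : 0 < T 1 := hT.1 ▸ hT.2.1 zero_lt_one
  have hR := h.R_first 0 le_rfl h1
  have hU := h.U_first 0 le_rfl h1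
  simp only [Set.Icc_self, Set.image_singleton, csInf_singleton, hf0, add_zero] at hR
  rw [max_eq_left (by linarith)] at hR
  rw [hU, hR, hf0]
  ring

/-- As long as `z + f` is nonnegative and at most `a` at the times `T j`, a triple started
from `y ≤ z` is dominated by `z + f` and undergoes no reflection at the upper level. -/
theorem U_le_and_L_eq_zero (h : IsPCTriple a T f y U L R) (hT : IsTimeGrid T) (hf0 : f 0 = 0)
    (hy : 0 ≤ y) {z : ℝ} (hyz : y ≤ z) (n : ℕ)
    (hpos : ∀ s, 0 ≤ s → s ≤ T n → 0 ≤ z + f s)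
    (hle : ∀ k, 1 ≤ k → k ≤ n → z + f (T k) ≤ a) :
    U (T n) ≤ z + f (T n) ∧ L (T n) = 0 := by
  induction n with
  | zero => simp [hT.1, h.U_zero hT hf0 hy, h.L_zero hT, hf0, hyz]
  | succ n ih =>
    have hlt : T n < T (n + 1) := hT.2.1 n.lt_succ_self
    have h0 : 0 ≤ T n := hT.1 ▸ hT.2.1.monotone n.zero_le
    obtain ⟨hU, hL⟩ := ih (fun s hs hsn => hpos s hs (hsn.trans hlt.le))
      (fun k hk hkn => hle k hk (hkn.trans n.le_succ))
    have hpush := max_zero_neg_sInf_image_Icc_le (g := fun s => U (T n) + f s - f (T n))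
      hlt.le (sub_nonneg.mpr hU) (fun s hs => by
        have := hpos s (h0.trans hs.1) hs.2
        linarith)
    have hR := h.R_jump n
    have ha := hle (n + 1) (by omega) le_rfl
    refine ⟨?_, ?_⟩
    · rw [h.U_jump]
      exact min_le_of_left_le (by linarith)
    · rw [h.L_jump, hL, max_eq_right (by linarith), add_zero]

/-- A triple started from `y ≤ z` undergoes no reflection at the upper level before
`TPlus a T f z` if the latter precedes `tauMinus f z`. -/
theorem L_eq_zero_of_lt_TPlus (h : IsPCTriple a T f y U L R) (hT : IsTimeGrid T)
    (hf0 : f 0 = 0) (hy : 0 ≤ y) {z : ℝ} (hyz : y ≤ z) (horder : TPlus a T f z < tauMinus f z)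
    {t : ℝ} (ht : 0 ≤ t) (htT : (t : EReal) < TPlus a T f z) : L t = 0 := by
  obtain ⟨k, hk, hk'⟩ := hT.exists_mem_Ico ht
  have before {s : ℝ} (hs : s ≤ T k) : (s : EReal) < TPlus a T f z :=
    (EReal.coe_le_coe_iff.mpr (hs.trans hk)).trans_lt htT
  have hL := (h.U_le_and_L_eq_zero hT hf0 hy hyz k
    (fun s hs hsk => nonneg_of_lt_tauMinus hs ((before hsk).trans horder))
    (fun j hj hjk => le_of_lt_TPlus hj (before (hT.2.1.monotone hjk)))).2
  rcases hk.eq_or_lt with rfl | hlt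
  · exact hL
  · rw [h.L_seg k t hlt hk', hL]

end IsPCTriple

/-- If `T_a^{(x+ε),+} < τ_0^{(x+ε),-}`, then
`inf {t > 0 : L⁽ˣ⁺ᵉ⁾ t - L⁽ˣ⁾ t > 0} ≥ T_a^{(x+ε),+}` (with `inf ∅ = +∞`);
in particular `L⁽ˣ⁺ᵉ⁾ t = L⁽ˣ⁾ t` for all `t ∈ [0, T_a^{(x+ε),+})`. -/
theorem stmt7
    (a : ℝ) (ha : 0 ≤ a) (T : ℕ → ℝ) (hT : IsTimeGrid T)
    (f : ℝ → ℝ) (hf : CadlagFun f) (hf0 : f 0 = 0)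
    (hfT : ∀ k : ℕ, 1 ≤ k → ContinuousAt f (T k))
    (x ε : ℝ) (hx : 0 ≤ x) (hε : 0 < ε)
    (U L R Ue Le Re : ℝ → ℝ)
    (hx_triple : IsPCTriple a T f x U L R)
    (hxe_triple : IsPCTriple a T f (x + ε) Ue Le Re)
    (horder : TPlus a T f (x + ε) < tauMinus f (x + ε)) :
    TPlus a T f (x + ε) ≤
      sInf ((fun t : ℝ => (t : EReal)) '' {t : ℝ | 0 < t ∧ 0 < Le t - L t}) ∧
    ∀ t : ℝ, 0 ≤ t → (t : EReal) < TPlus a T f (x + ε) → Le t = L t := by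
  have heq : ∀ t : ℝ, 0 ≤ t → (t : EReal) < TPlus a T f (x + ε) → Le t = L t :=
    fun t ht htT =>
      (hxe_triple.L_eq_zero_of_lt_TPlus hT hf0 (by linarith) le_rfl horder ht htT).trans
        (hx_triple.L_eq_zero_of_lt_TPlus hT hf0 hx (by linarith) horder ht htT).symm
  refine ⟨le_sInf ?_, heq⟩
  rintro _ ⟨t, ⟨ht, hpos⟩, rfl⟩
  by_contra! hlt
  exact hpos.ne' (sub_eq_zero.mpr (heq t ht.le hlt))
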